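/- For every real λ ≥ 0, the binary-input AWGN channel with SNR λ satisfies C(λ) ≥ B(λ) ≥ R₀(λ), where C(λ) = 1 − (1/√π)·∫_{−∞}^{∞} e^{−(y−√λ)²}·log₂(1 + e^{−4y√λ}) dy, B(λ) = 1 − e^{−λ}, and R₀(λ) = 1 − log₂(1 + e^{−λ}). Equivalently, (1/√π)·∫_{−∞}^{∞} e^{−(y−√λ)²}·log₂(1 + e^{−4y√λ}) dy ≤ e^{−λ} ≤ log₂(1 + e^{−λ}). -/

import Mathlib

open MeasureTheory Real

lemma sinh_mul_log_two_cosh_le {t : ℝ} (ht : 0 ≤ t) :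
    sinh t * log (2 * cosh t) ≤ t * cosh t := by
  have hlog : log (2 * cosh t) ≤ t + exp (-t) * exp (-t) := by
    have h : 2 * cosh t = exp t * (1 + exp (-t) * exp (-t)) := by
      have : exp t * exp (-t) = 1 := by rw [← exp_add]; simp
      rw [cosh_eq]
      linear_combination (-exp (-t)) * this
    rw [h, log_mul (exp_pos _).ne' (by positivity), log_exp]
    have := log_le_sub_one_of_pos (x := 1 + exp (-t) * exp (-t)) (by positivity)
    linarith
  refine (mul_le_mul_of_nonneg_left hlog (sinh_nonneg_iff.2 ht)).trans ?_
  have h1 : exp t * exp (-t) = 1 := by rw [← exp_add]; simp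
  have h2 : 1 - exp (-t) * exp (-t) ≤ 2 * t := by
    rw [← exp_add]
    linarith [add_one_le_exp (-t + -t)]
  rw [cosh_eq, sinh_eq]
  linear_combination mul_le_mul_of_nonneg_left h2 (exp_pos (-t)).le / 2 + exp (-t) / 2 * h1

lemma cosh_mul_log_two_cosh_sub_le (t : ℝ) :
    cosh t * log (2 * cosh t) - t * sinh t ≤ log 2 := by
  have hderiv (x : ℝ) : HasDerivAt (fun t ↦ cosh t * log (2 * cosh t) - t * sinh t)
      (sinh x * log (2 * cosh x) - x * cosh x) x := by
    have hc := (cosh_pos x).ne'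
    refine (((hasDerivAt_cosh x).mul (((hasDerivAt_cosh x).const_mul 2).log (by positivity))).sub
      ((hasDerivAt_id x).mul (hasDerivAt_sinh x))).congr_deriv ?_
    simp only [id]
    field_simp
    ring
  have hanti : AntitoneOn (fun t ↦ cosh t * log (2 * cosh t) - t * sinh t) (Set.Ici 0) := by
    refine antitoneOn_of_hasDerivWithinAt_nonpos (convex_Ici 0)
      (fun x _ ↦ (hderiv x).continuousAt.continuousWithinAt)
      (fun x _ ↦ (hderiv x).hasDerivWithinAt) fun x hx ↦ ?_
    rw [interior_Ici] at hx
    exact sub_nonpos.2 (sinh_mul_log_two_cosh_le (le_of_lt hx))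
  have h := hanti (Set.mem_Ici.2 le_rfl) (Set.mem_Ici.2 (abs_nonneg t)) (abs_nonneg t)
  rcases abs_choice t with h' | h' <;> simpa [h'] using h

/-- The binary entropy bound `h(p) ≤ 2 √(p (1 - p))`, written in terms of half the log-likelihood
ratio `t` of `p` and `1 - p`. -/
lemma exp_mul_logb_add_exp_neg_mul_logb_le (t : ℝ) :
    exp t * logb 2 (1 + exp (-2 * t)) + exp (-t) * logb 2 (1 + exp (2 * t)) ≤ 2 := by
  have key (s : ℝ) : log (1 + exp (-2 * s)) = log (2 * cosh s) - s := by
    have h : 1 + exp (-2 * s) = 2 * cosh s * exp (-s) := by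
      rw [cosh_eq, mul_div_cancel₀ _ two_ne_zero, add_mul, ← exp_add, ← exp_add]
      ring_nf
      simp [add_comm]
    rw [h, log_mul (by have := cosh_pos s; positivity) (exp_pos _).ne', log_exp, sub_eq_add_neg]
  have h1 := key t
  have h2 := key (-t)
  rw [cosh_neg, show -2 * -t = 2 * t by ring] at h2
  have hlog : 0 < log 2 := log_pos one_lt_two
  have h := cosh_mul_log_two_cosh_sub_le t
  rw [logb, logb, h1, h2, ← mul_div_assoc, ← mul_div_assoc, ← add_div, div_le_iff₀ hlog]
  generalize log (2 * cosh t) = L at h ⊢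
  rw [cosh_eq, sinh_eq] at h
  linarith

lemma le_logb_two_one_add {x : ℝ} (h0 : 0 ≤ x) (h1 : x ≤ 1) : x ≤ logb 2 (1 + x) := by
  rw [le_logb_iff_rpow_le one_lt_two (by positivity)]
  have := rpow_one_add_le_one_add_mul_self (s := 1) (by norm_num) h0 h1
  norm_num at this
  exact this

lemma integral_le_of_add_comp_neg_le {f g : ℝ → ℝ} (hg : Integrable g) (hg0 : 0 ≤ g)
    (hfg : ∀ y, f y + f (-y) ≤ 2 * g y) : ∫ y, f y ≤ ∫ y, g y := by
  by_cases hf : Integrable f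
  · have h := integral_mono (hf.add hf.comp_neg) (hg.const_mul 2) hfg
    simp only [Pi.add_apply] at h
    rw [integral_add hf hf.comp_neg, integral_neg_eq_self, integral_const_mul] at h
    linarith
  · rw [integral_undef hf]
    exact integral_nonneg hg0

/-- For the binary-input AWGN channel with SNR `λ ≥ 0`, the capacity, the Bhattacharyya
rate, and the cutoff rate satisfy `C(λ) ≥ B(λ) ≥ R₀(λ)`; equivalently,
`(1/√π)·∫ e^{-(y-√λ)²} log₂(1+e^{-4y√λ}) dy ≤ e^{-λ} ≤ log₂(1+e^{-λ})`. -/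
theorem biawgn_capacity_ge_bhattacharyya_rate_ge_cutoff_rate (l : ℝ) (hl : 0 ≤ l) :
    (1 / Real.sqrt π) *
        (∫ y : ℝ, Real.exp (-(y - Real.sqrt l) ^ 2) *
          Real.logb 2 (1 + Real.exp (-4 * y * Real.sqrt l))) ≤ Real.exp (-l) ∧
      Real.exp (-l) ≤ Real.logb 2 (1 + Real.exp (-l)) := by
  refine ⟨?_, le_logb_two_one_add (exp_pos _).le (exp_le_one_iff.2 (by linarith))⟩
  have hint : ∫ y : ℝ, exp (-l) * exp (-1 * y ^ 2) = exp (-l) * √π := by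
    rw [integral_const_mul, integral_gaussian, div_one]
  rw [one_div, inv_mul_le_iff₀ (by positivity), mul_comm, ← hint]
  refine integral_le_of_add_comp_neg_le ((integrable_exp_neg_mul_sq one_pos).const_mul _)
    (fun y ↦ by positivity) fun y ↦ ?_
  have hs : √l ^ 2 = l := sq_sqrt hl
  have h1 : exp (-(y - √l) ^ 2) = exp (-l) * exp (-1 * y ^ 2) * exp (2 * y * √l) := by
    rw [← exp_add, ← exp_add]
    congr 1
    linear_combination -hs
  have h2 : exp (-(-y - √l) ^ 2) = exp (-l) * exp (-1 * y ^ 2) * exp (-(2 * y * √l)) := by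
    rw [← exp_add, ← exp_add]
    congr 1
    linear_combination -hs
  rw [h1, h2, show -4 * y * √l = -2 * (2 * y * √l) by ring,
    show -4 * -y * √l = 2 * (2 * y * √l) by ring, mul_assoc _ (exp (2 * y * √l)),
    mul_assoc _ (exp (-(2 * y * √l))), ← mul_add,
    mul_comm 2 (exp (-l) * _)]
  exact mul_le_mul_of_nonneg_left (exp_mul_logb_add_exp_neg_mul_logb_le _) (by positivity)
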